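/- Let (A, ·) be a finite-dimensional anti-flexible algebra over a field F of characteristic ≠ 2 and let r ∈ A⊗A be skew-symmetric (σr = −r). If r satisfies the anti-flexible Yang–Baxter equation r₁₂·r₁₃ − r₂₃·r₁₂ + r₁₃·r₂₃ = 0, then (A, Δ) is an anti-flexible bialgebra, where Δ(x) = (id ⊗ L(x))r + (R(x) ⊗ id)σr for x ∈ A. -/

import Mathlib

open LinearMap Module TensorProduct

def IsAntiFlexible {F : Type*} [Field F] {A : Type*} [AddCommGroup A] [Module F A]
    (m : A →ₗ[F] A →ₗ[F] A) : Prop :=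
  ∀ x y z : A, m (m x y) z - m x (m y z) = m (m z y) x - m z (m y x)

variable {F : Type*} [Field F] {A : Type*} [AddCommGroup A] [Module F A]

noncomputable def mulMap (m : A →ₗ[F] A →ₗ[F] A) : A ⊗[F] A →ₗ[F] A :=
  TensorProduct.lift m

/-- `(a⊗b)⊗(c⊗d) ↦ (a·c) ⊗ b ⊗ d`; applied to `r ⊗ r` this yields `r₁₂·r₁₃`. -/
noncomputable def prod1213 (m : A →ₗ[F] A →ₗ[F] A) :
    (A ⊗[F] A) ⊗[F] (A ⊗[F] A) →ₗ[F] (A ⊗[F] A) ⊗[F] A :=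
  (TensorProduct.assoc F A A A).symm.toLinearMap
    ∘ₗ TensorProduct.map (mulMap m) LinearMap.id
    ∘ₗ (tensorTensorTensorComm F A A A A).toLinearMap

/-- `(a⊗b)⊗(c⊗d) ↦ a ⊗ c ⊗ (b·d)`; applied to `r ⊗ r` this yields `r₁₃·r₂₃`. -/
noncomputable def prod1323 (m : A →ₗ[F] A →ₗ[F] A) :
    (A ⊗[F] A) ⊗[F] (A ⊗[F] A) →ₗ[F] (A ⊗[F] A) ⊗[F] A :=
  TensorProduct.map LinearMap.id (mulMap m)
    ∘ₗ (tensorTensorTensorComm F A A A A).toLinearMap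

/-- `(a⊗b)⊗(c⊗d) ↦ c ⊗ (a·d) ⊗ b`; applied to `r ⊗ r` this yields `r₂₃·r₁₂`. -/
noncomputable def prod2312 (m : A →ₗ[F] A →ₗ[F] A) :
    (A ⊗[F] A) ⊗[F] (A ⊗[F] A) →ₗ[F] (A ⊗[F] A) ⊗[F] A :=
  TensorProduct.map
      (TensorProduct.map LinearMap.id (mulMap m) ∘ₗ (TensorProduct.assoc F A A A).toLinearMap)
      LinearMap.id
    ∘ₗ (TensorProduct.assoc F (A ⊗[F] A) A A).symm.toLinearMap
    ∘ₗ (tensorTensorTensorComm F A A A A).toLinearMap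
    ∘ₗ (TensorProduct.comm F (A ⊗[F] A) (A ⊗[F] A)).toLinearMap

/-- The anti-flexible Yang–Baxter equation `r₁₂·r₁₃ − r₂₃·r₁₂ + r₁₃·r₂₃ = 0`. -/
def IsAFYBESolution (m : A →ₗ[F] A →ₗ[F] A) (r : A ⊗[F] A) : Prop :=
  prod1213 m (r ⊗ₜ[F] r) - prod2312 m (r ⊗ₜ[F] r) + prod1323 m (r ⊗ₜ[F] r) = 0

/-- The coboundary comultiplication `Δ(x) = (id ⊗ L(x))r + (R(x) ⊗ id)σr`. -/
noncomputable def coboundaryDelta (m : A →ₗ[F] A →ₗ[F] A) (r : A ⊗[F] A) :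
    A →ₗ[F] A ⊗[F] A :=
  (LinearMap.applyₗ r ∘ₗ LinearMap.lTensorHom A) ∘ₗ m
    + (LinearMap.applyₗ (TensorProduct.comm F A A r) ∘ₗ LinearMap.rTensorHom A) ∘ₗ m.flip

/-- The product on `A*` induced by a comultiplication `Δ : A → A ⊗ A`. -/
noncomputable def dualProd (Δ : A →ₗ[F] A ⊗[F] A) :
    Dual F A →ₗ[F] Dual F A →ₗ[F] Dual F A :=
  TensorProduct.curry (Δ.dualMap ∘ₗ TensorProduct.dualDistrib F A A)

def BialgCondI (m : A →ₗ[F] A →ₗ[F] A) (Δ : A →ₗ[F] A ⊗[F] A) : Prop :=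
  ∀ x y : A,
    Δ (m x y) + TensorProduct.comm F A A (Δ (m y x)) =
      TensorProduct.comm F A A (TensorProduct.map LinearMap.id (m y) (Δ x))
        + TensorProduct.map (m.flip y) LinearMap.id (Δ x)
        + TensorProduct.comm F A A (TensorProduct.map (m.flip x) LinearMap.id (Δ y))
        + TensorProduct.map LinearMap.id (m x) (Δ y)

def BialgCondII (m : A →ₗ[F] A →ₗ[F] A) (Δ : A →ₗ[F] A ⊗[F] A) : Prop :=
  ∀ x y : A,
    TensorProduct.comm F A A (TensorProduct.map LinearMap.id (m.flip y) (Δ x))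
        - TensorProduct.map LinearMap.id (m.flip y) (Δ x)
        - TensorProduct.comm F A A (TensorProduct.map (m y) LinearMap.id (Δ x))
        + TensorProduct.map (m y) LinearMap.id (Δ x) =
      TensorProduct.comm F A A (TensorProduct.map LinearMap.id (m.flip x) (Δ y))
        - TensorProduct.map LinearMap.id (m.flip x) (Δ y)
        - TensorProduct.comm F A A (TensorProduct.map (m x) LinearMap.id (Δ y))
        + TensorProduct.map (m x) LinearMap.id (Δ y)

namespace IsAntiFlexible

variable {m : A →ₗ[F] A →ₗ[F] A}

lemma mul_add_mul_flip (hm : IsAntiFlexible m) (x y : A) :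
    m (m x y) + m.flip (m y x) = m.flip x ∘ₗ m.flip y + m x ∘ₗ m y := by
  ext b
  have h := hm x y b
  simp only [LinearMap.add_apply, LinearMap.comp_apply, LinearMap.flip_apply]
  rw [sub_eq_sub_iff_add_eq_add] at h
  rw [h]

lemma flip_comp_add_comp_flip (hm : IsAntiFlexible m) (x y : A) :
    m.flip y ∘ₗ m x + m y ∘ₗ m.flip x = m.flip x ∘ₗ m y + m x ∘ₗ m.flip y := by
  ext b
  have h := hm x b y
  simp only [LinearMap.add_apply, LinearMap.comp_apply, LinearMap.flip_apply]
  rwa [sub_eq_sub_iff_add_eq_add] at h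

end IsAntiFlexible

section Skew

variable (m : A →ₗ[F] A →ₗ[F] A) {r : A ⊗[F] A}

lemma comm_map_of_skew (hskew : TensorProduct.comm F A A r = -r) (u v : A →ₗ[F] A) :
    TensorProduct.comm F A A (TensorProduct.map u v r) = -TensorProduct.map v u r := by
  rw [← TensorProduct.map_comm, hskew, map_neg]

lemma coboundaryDelta_apply_of_skew (hskew : TensorProduct.comm F A A r = -r) (x : A) :
    coboundaryDelta m r x =
      TensorProduct.map LinearMap.id (m x) r - TensorProduct.map (m.flip x) LinearMap.id r := by
  simp [coboundaryDelta, hskew, LinearMap.lTensor, LinearMap.rTensor, sub_eq_add_neg]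

variable {m}

lemma bialgCondI_coboundaryDelta (hm : IsAntiFlexible m)
    (hskew : TensorProduct.comm F A A r = -r) : BialgCondI m (coboundaryDelta m r) := by
  intro x y
  have h₁ := congrArg (fun u => TensorProduct.map LinearMap.id u r) (hm.mul_add_mul_flip x y)
  have h₂ := congrArg (fun u => TensorProduct.map u LinearMap.id r) (hm.mul_add_mul_flip y x)
  simp only [TensorProduct.map_add_left, TensorProduct.map_add_right, LinearMap.add_apply]
    at h₁ h₂
  simp only [coboundaryDelta_apply_of_skew m hskew, map_sub, TensorProduct.map_map,
    comm_map_of_skew hskew, LinearMap.id_comp, LinearMap.comp_id]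
  linear_combination (norm := module) h₁ - h₂

lemma bialgCondII_coboundaryDelta (hm : IsAntiFlexible m)
    (hskew : TensorProduct.comm F A A r = -r) : BialgCondII m (coboundaryDelta m r) := by
  intro x y
  have h₁ := congrArg (fun u => TensorProduct.map LinearMap.id u r)
    (hm.flip_comp_add_comp_flip x y)
  have h₂ := congrArg (fun u => TensorProduct.map u LinearMap.id r)
    (hm.flip_comp_add_comp_flip x y)
  simp only [TensorProduct.map_add_left, TensorProduct.map_add_right, LinearMap.add_apply]
    at h₁ h₂
  simp only [coboundaryDelta_apply_of_skew m hskew, map_sub, TensorProduct.map_map,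
    comm_map_of_skew hskew, LinearMap.id_comp, LinearMap.comp_id]
  linear_combination (norm := module) -h₁ - h₂

end Skew

/-- Contraction of the second tensor factor: `a ⊗ b ↦ g(b) a`. -/
noncomputable def contractSnd (t : A ⊗[F] A) (g : Dual F A) : A :=
  TensorProduct.rid F A (g.lTensor A t)

@[simp]
lemma contractSnd_tmul (a b : A) (g : Dual F A) : contractSnd (a ⊗ₜ[F] b) g = g b • a := by
  simp [contractSnd]

@[simp]
lemma contractSnd_add (s t : A ⊗[F] A) (g : Dual F A) :
    contractSnd (s + t) g = contractSnd s g + contractSnd t g := by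
  simp [contractSnd]

@[simp]
lemma contractSnd_zero (g : Dual F A) : contractSnd (0 : A ⊗[F] A) g = 0 := by
  simp [contractSnd]

@[simp]
lemma contractSnd_neg (t : A ⊗[F] A) (g : Dual F A) :
    contractSnd (-t) g = -contractSnd t g := by
  simp [contractSnd]

lemma dualDistrib_map (u v : A →ₗ[F] A) (f g : Dual F A) (t : A ⊗[F] A) :
    TensorProduct.dualDistrib F A A (f ⊗ₜ g) (TensorProduct.map u v t) =
      f (u (contractSnd t (g ∘ₗ v))) := by
  induction t with
  | zero => simp
  | tmul a b => simp [mul_comm]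
  | add s t hs ht => simp [hs, ht]

lemma dualDistrib_map_comm (u v : A →ₗ[F] A) (f g : Dual F A) (t : A ⊗[F] A) :
    TensorProduct.dualDistrib F A A (f ⊗ₜ g) (TensorProduct.map u v t) =
      g (v (contractSnd (TensorProduct.comm F A A t) (f ∘ₗ u))) := by
  induction t with
  | zero => simp
  | tmul a b => simp
  | add s t hs ht => simp [hs, ht]

section Pairing

variable (m : A →ₗ[F] A →ₗ[F] A) (f g h : Dual F A)

/-- The functional `a ⊗ b ⊗ c ↦ f(a) g(b) h(c)`. -/
noncomputable def tripleDual : Dual F ((A ⊗[F] A) ⊗[F] A) :=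
  TensorProduct.dualDistrib F (A ⊗[F] A) A (TensorProduct.dualDistrib F A A (f ⊗ₜ g) ⊗ₜ h)

lemma tripleDual_prod1213 (s t : A ⊗[F] A) :
    tripleDual f g h (prod1213 m (s ⊗ₜ t)) = f (m (contractSnd s g) (contractSnd t h)) := by
  induction s with
  | zero => simp
  | add s s' hs hs' => simp [TensorProduct.add_tmul, hs, hs']
  | tmul a b =>
    induction t with
    | zero => simp
    | add t t' ht ht' => simp_all [TensorProduct.tmul_add]
    | tmul c d =>
      simp [tripleDual, prod1213, mulMap]
      ring

lemma tripleDual_prod2312 (s t : A ⊗[F] A) :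
    tripleDual f g h (prod2312 m (s ⊗ₜ t)) =
      g (m (contractSnd s h) (contractSnd (TensorProduct.comm F A A t) f)) := by
  induction s with
  | zero => simp
  | add s s' hs hs' => simp [TensorProduct.add_tmul, hs, hs']
  | tmul a b =>
    induction t with
    | zero => simp
    | add t t' ht ht' => simp_all [TensorProduct.tmul_add]
    | tmul c d =>
      simp [tripleDual, prod2312, mulMap]
      ring

lemma tripleDual_prod1323 (s t : A ⊗[F] A) :
    tripleDual f g h (prod1323 m (s ⊗ₜ t)) =
      h (m (contractSnd (TensorProduct.comm F A A s) f)
        (contractSnd (TensorProduct.comm F A A t) g)) := by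
  induction s with
  | zero => simp
  | add s s' hs hs' => simp [TensorProduct.add_tmul, hs, hs']
  | tmul a b =>
    induction t with
    | zero => simp
    | add t t' ht ht' => simp_all [TensorProduct.tmul_add]
    | tmul c d =>
      simp [tripleDual, prod1323, mulMap]
      ring

end Pairing

section DualProduct

variable {m : A →ₗ[F] A →ₗ[F] A} {r : A ⊗[F] A}

lemma apply_contractSnd_of_skew (hskew : TensorProduct.comm F A A r = -r) (f g : Dual F A) :
    f (contractSnd r g) = -g (contractSnd r f) := by
  have h₁ := dualDistrib_map LinearMap.id LinearMap.id f g r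
  have h₂ := dualDistrib_map_comm LinearMap.id LinearMap.id f g r
  simpa [hskew] using h₁.symm.trans h₂

lemma dualProd_coboundaryDelta_apply (hskew : TensorProduct.comm F A A r = -r)
    (f g : Dual F A) (x : A) :
    _root_.dualProd (coboundaryDelta m r) f g x =
      -g (m x (contractSnd r f)) - f (m (contractSnd r g) x) := by
  change TensorProduct.dualDistrib F A A (f ⊗ₜ g) (coboundaryDelta m r x) = _
  rw [coboundaryDelta_apply_of_skew m hskew, map_sub, dualDistrib_map_comm, dualDistrib_map]
  simp [hskew]

lemma IsAFYBESolution.pairing_eq_zero (hsol : IsAFYBESolution m r)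
    (hskew : TensorProduct.comm F A A r = -r) (f g h : Dual F A) :
    f (m (contractSnd r g) (contractSnd r h)) + g (m (contractSnd r h) (contractSnd r f))
      + h (m (contractSnd r f) (contractSnd r g)) = 0 := by
  have key := congrArg (tripleDual f g h) hsol
  simpa [tripleDual_prod1213, tripleDual_prod2312, tripleDual_prod1323, hskew] using key

/-- Up to sign, contraction with `r` is a homomorphism from the dual product to `m`. -/
lemma IsAFYBESolution.contractSnd_dualProd (hsol : IsAFYBESolution m r)
    (hskew : TensorProduct.comm F A A r = -r) (g h : Dual F A) :
    contractSnd r (_root_.dualProd (coboundaryDelta m r) g h) =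
      -m (contractSnd r g) (contractSnd r h) := by
  rw [← sub_eq_zero, ← Module.forall_dual_apply_eq_zero_iff F]
  intro f
  rw [map_sub, map_neg, apply_contractSnd_of_skew hskew, dualProd_coboundaryDelta_apply hskew]
  linear_combination hsol.pairing_eq_zero hskew f g h

lemma IsAFYBESolution.isAntiFlexible_dualProd (hsol : IsAFYBESolution m r)
    (hm : IsAntiFlexible m) (hskew : TensorProduct.comm F A A r = -r) :
    IsAntiFlexible (_root_.dualProd (coboundaryDelta m r)) := by
  intro f g h
  ext x
  have hf := congrArg f (hm x (contractSnd r h) (contractSnd r g))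
  have hg := congrArg g (hm (contractSnd r h) x (contractSnd r f))
  have hh := congrArg h (hm x (contractSnd r f) (contractSnd r g))
  simp only [map_sub] at hf hg hh
  simp only [LinearMap.sub_apply, dualProd_coboundaryDelta_apply hskew,
    hsol.contractSnd_dualProd hskew, map_neg, LinearMap.neg_apply]
  linear_combination hf + hg - hh

end DualProduct

/-- a skew-symmetric solution of the anti-flexible Yang–Baxter equation
gives an anti-flexible bialgebra via `Δ(x) = (id ⊗ L(x))r + (R(x) ⊗ id)σr`. -/
theorem afybe_solution_gives_bialgebra [FiniteDimensional F A]
    (hchar : (2 : F) ≠ 0)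
    (m : A →ₗ[F] A →ₗ[F] A) (hm : IsAntiFlexible m)
    (r : A ⊗[F] A) (hskew : TensorProduct.comm F A A r = -r)
    (hsol : IsAFYBESolution m r) :
    IsAntiFlexible (dualProd (coboundaryDelta m r)) ∧
      BialgCondI m (coboundaryDelta m r) ∧ BialgCondII m (coboundaryDelta m r) := by
  exact ⟨hsol.isAntiFlexible_dualProd hm hskew, bialgCondI_coboundaryDelta hm hskew,
    bialgCondII_coboundaryDelta hm hskew⟩
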